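/- For every integer n ≥ 1, define U_n = ∑_{r=0}^{n} (-1)^r q^{r(r-1)/2} (-q;q)_{n-r} [2n-r+1 choose r]_q. Then the following telescoping identity holds in ℚ(q): ∑_{r=0}^{n} (-1)^r q^{r(r-1)/2} (-q;q)_{n-r} [2n-r+1 choose r]_q · (1-q^{2n+1})/(1-q^{2n-r+1}) = U_n - q^{2n} U_{n-1}. -/

import Mathlib

open Finset

/-- The indeterminate `q`, as an element of the field `ℚ(q)` of rational functions. -/
noncomputable def q : RatFunc ℚ := RatFunc.X

/-- The q-Pochhammer symbol `(a; q)_n` for a nonnegative integer `n`. -/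
noncomputable def qPoch (a : RatFunc ℚ) (n : ℕ) : RatFunc ℚ :=
  ∏ k ∈ Finset.range n, (1 - a * q ^ k)

/-- The q-Pochhammer symbol `(a; q)_n` for an arbitrary integer `n`, where for `n > 0`
`(a; q)_{-n} = 1 / (a q^{-n}; q)_n`. -/
noncomputable def qPochZ (a : RatFunc ℚ) (n : ℤ) : RatFunc ℚ :=
  if 0 ≤ n then qPoch a n.toNat else 1 / qPoch (a * q ^ n) (-n).toNat

/-- The Gaussian (q-)binomial coefficient `[n choose m]_q`, equal to
`(q;q)_n / ((q;q)_m (q;q)_{n-m})` for `0 ≤ m ≤ n` and `0` otherwise. -/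
noncomputable def qbinom (n m : ℤ) : RatFunc ℚ :=
  if 0 ≤ m ∧ m ≤ n then
    qPoch q n.toNat / (qPoch q m.toNat * qPoch q (n - m).toNat)
  else 0

/-- `U_n = ∑_{r=0}^n (-1)^r q^(C(r,2)) (-q;q)_(n-r) [2n-r+1, r]_q`. -/
noncomputable def Un (n : ℕ) : RatFunc ℚ :=
  ∑ r ∈ Finset.range (n + 1),
    (-1 : RatFunc ℚ) ^ r * q ^ (r * (r - 1) / 2) * qPoch (-q) (n - r) *
      qbinom (2 * (n : ℤ) - r + 1) r

lemma one_sub_q_pow_succ_ne_zero (n : ℕ) : 1 - q ^ (n + 1) ≠ 0 := by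
  intro h
  have hpow : (RatFunc.X : RatFunc ℚ) ^ (n + 1) = 1 := (sub_eq_zero.mp h).symm
  rw [← RatFunc.algebraMap_X, ← map_pow, ← map_one (algebraMap (Polynomial ℚ) (RatFunc ℚ))] at hpow
  have hdeg := congrArg Polynomial.natDegree (RatFunc.algebraMap_injective ℚ hpow)
  simp at hdeg

lemma qPoch_q_succ (n : ℕ) : qPoch q (n + 1) = qPoch q n * (1 - q ^ (n + 1)) := by
  rw [qPoch, Finset.prod_range_succ, ← pow_succ']
  rfl

lemma qPoch_q_ne_zero (n : ℕ) : qPoch q n ≠ 0 := by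
  refine Finset.prod_ne_zero_iff.mpr fun k _ => ?_
  rw [← pow_succ']
  exact one_sub_q_pow_succ_ne_zero k

lemma qbinom_natCast_add (k d : ℕ) :
    qbinom ((k + d : ℕ) : ℤ) (k : ℤ) = qPoch q (k + d) / (qPoch q k * qPoch q d) := by
  have hd : (((k + d : ℕ) : ℤ) - (k : ℤ)).toNat = d := by omega
  rw [qbinom, if_pos (by omega), hd, Int.toNat_natCast, Int.toNat_natCast]

/-- The absorption identity for Gaussian binomial coefficients. -/
lemma qbinom_succ_succ_mul (k d : ℕ) :
    qbinom ((k + 1 + d : ℕ) : ℤ) ((k + 1 : ℕ) : ℤ) * (1 - q ^ (k + 1)) =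
      qbinom ((k + d : ℕ) : ℤ) (k : ℤ) * (1 - q ^ (k + d + 1)) := by
  rw [qbinom_natCast_add, qbinom_natCast_add, Nat.add_right_comm, qPoch_q_succ, qPoch_q_succ]
  have := qPoch_q_ne_zero k
  have := qPoch_q_ne_zero d
  have := one_sub_q_pow_succ_ne_zero k
  field_simp

/-- The telescoping identity from the proof of Theorem 2.1. -/
theorem U_telescoping (n : ℕ) (hn : 1 ≤ n) :
    ∑ r ∈ Finset.range (n + 1),
        (-1 : RatFunc ℚ) ^ r * q ^ (r * (r - 1) / 2) * qPoch (-q) (n - r) *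
          qbinom (2 * (n : ℤ) - r + 1) r *
          ((1 - q ^ (2 * n + 1)) / (1 - q ^ (2 * (n : ℤ) - r + 1))) =
      Un n - q ^ (2 * n) * Un (n - 1) := by
  obtain ⟨m, rfl⟩ := Nat.exists_eq_add_of_le' hn
  rw [Nat.add_sub_cancel, Un, Un, Finset.sum_range_succ', Finset.sum_range_succ' _ (m + 1),
    add_sub_right_comm, Finset.mul_sum, ← Finset.sum_sub_distrib]
  congr 1
  · refine Finset.sum_congr rfl fun s hs => ?_
    obtain ⟨t, rfl⟩ := Nat.exists_eq_add_of_le (Finset.mem_range_succ_iff.mp hs)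
    have htop : 2 * ((s + t + 1 : ℕ) : ℤ) - ((s + 1 : ℕ) : ℤ) + 1 =
        ((s + 1 + (2 * t + 1) : ℕ) : ℤ) := by push_cast; ring
    have hbot : 2 * ((s + t : ℕ) : ℤ) - (s : ℤ) + 1 = ((s + (2 * t + 1) : ℕ) : ℤ) := by
      push_cast; ring
    have hchoose : (s + 1) * (s + 1 - 1) / 2 = s * (s - 1) / 2 + s := by
      rw [← Finset.sum_range_id_mul_two, ← Finset.sum_range_id_mul_two,
        Nat.mul_div_cancel _ two_pos, Nat.mul_div_cancel _ two_pos, Finset.sum_range_succ]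
    have habs := qbinom_succ_succ_mul s (2 * t + 1)
    have hne := one_sub_q_pow_succ_ne_zero (s + (2 * t + 1))
    rw [htop, hbot, hchoose, zpow_natCast, show s + t + 1 - (s + 1) = t by omega,
      show s + t - s = t by omega, show s + 1 + (2 * t + 1) = s + (2 * t + 1) + 1 by ring]
    rw [show s + 1 + (2 * t + 1) = s + (2 * t + 1) + 1 by ring] at habs
    generalize qbinom ((s + (2 * t + 1) + 1 : ℕ) : ℤ) ((s + 1 : ℕ) : ℤ) = B at *
    generalize qbinom ((s + (2 * t + 1) : ℕ) : ℤ) (s : ℤ) = C at *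
    obtain rfl : C = B * (1 - q ^ (s + 1)) / (1 - q ^ (s + (2 * t + 1) + 1)) :=
      eq_div_of_mul_eq hne habs.symm
    field_simp
    ring
  · have hne := one_sub_q_pow_succ_ne_zero (2 * (m + 1))
    have hexp : 2 * ((m + 1 : ℕ) : ℤ) - ((0 : ℕ) : ℤ) + 1 = ((2 * (m + 1) + 1 : ℕ) : ℤ) := by
      push_cast; ring
    rw [hexp, zpow_natCast, div_self hne, mul_one]
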